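/- Let H be a complex Hilbert space, let X ⊆ H be a complete (closed) subspace with orthogonal projection P_X : H → H, let N ≥ 1 be a natural number, and let u₁, …, u_N be unitary operators on H such that u_i(X) is (1/N)-orthogonal to u_j(X) for all i ≠ j, i.e. |⟨ξ, η⟩| ≤ (1/N)‖ξ‖‖η‖ for all ξ ∈ u_i(X), η ∈ u_j(X). Then for every vector v ∈ H satisfying u_j(v) = v for all j = 1, …, N, one has ‖P_X(v)‖² ≤ (√2/√N)·‖v‖². -/

import Mathlib

open scoped ComplexInnerProductSpace

/-- If `N` vectors of norm `r` have pairwise inner products at most `r ^ 2 / N` in modulus, then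
their sum has squared norm at most `2 * N * r ^ 2`. -/
theorem norm_sum_sq_le_of_almost_orthogonal
    {H : Type*} [NormedAddCommGroup H] [InnerProductSpace ℂ H]
    {N : ℕ} (hN : 1 ≤ N) (x : Fin N → H) {r : ℝ} (hx : ∀ i, ‖x i‖ = r)
    (h : ∀ i j, i ≠ j → ‖⟪x i, x j⟫‖ ≤ r ^ 2 / N) :
    ‖∑ i, x i‖ ^ 2 ≤ 2 * N * r ^ 2 := by
  have hN0 : (N : ℝ) ≠ 0 := by positivity
  have hij (i j : Fin N) : ‖⟪x i, x j⟫‖ ≤ (if i = j then r ^ 2 else 0) + r ^ 2 / N := by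
    by_cases hij : i = j
    · subst hij
      have : ‖⟪x i, x i⟫‖ ≤ r ^ 2 := by
        simp [hx]
      have : 0 ≤ r ^ 2 / N := by positivity
      simp only [if_true]
      linarith
    · simpa [hij] using h i j hij
  calc ‖∑ i, x i‖ ^ 2 = ‖⟪∑ i, x i, ∑ j, x j⟫‖ := by
        rw [inner_self_eq_norm_sq_to_K]
        simp
    _ = ‖∑ i, ∑ j, ⟪x i, x j⟫‖ := by simp_rw [sum_inner, inner_sum]
    _ ≤ ∑ i, ∑ j, ‖⟪x i, x j⟫‖ :=
        (norm_sum_le _ _).trans (Finset.sum_le_sum fun i _ => norm_sum_le _ _)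
    _ ≤ ∑ i : Fin N, ∑ j : Fin N, ((if i = j then r ^ 2 else 0) + r ^ 2 / N) :=
        Finset.sum_le_sum fun i _ => Finset.sum_le_sum fun j _ => hij i j
    _ = 2 * N * r ^ 2 := by
        simp [Finset.sum_add_distrib]
        field_simp
        ring

/-- Exact-invariance version of the Claim 2 estimate: if the `N` unitary translates
`uⱼ(X)` of a closed subspace `X` are pairwise (1/N)-orthogonal and `v` is fixed by
each `uⱼ`, then `‖P_X v‖² ≤ (√2/√N)·‖v‖²`. -/
theorem norm_sq_proj_le_of_invariant_vector
    {H : Type*} [NormedAddCommGroup H] [InnerProductSpace ℂ H]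
    (X : Submodule ℂ H) [CompleteSpace X]
    (N : ℕ) (hN : 1 ≤ N) (u : Fin N → (H ≃ₗᵢ[ℂ] H))
    (horth : ∀ i j : Fin N, i ≠ j → ∀ ξ ∈ X, ∀ η ∈ X,
      ‖⟪u i ξ, u j η⟫‖ ≤ (1 / (N : ℝ)) * ‖u i ξ‖ * ‖u j η‖)
    (v : H) (hv : ∀ j : Fin N, u j v = v) :
    ‖(Submodule.orthogonalProjectionOnto X v : H)‖ ^ 2 ≤
      (Real.sqrt 2 / Real.sqrt N) * ‖v‖ ^ 2 := by
  set p : H := (Submodule.orthogonalProjectionOnto X v : H)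
  have hpX : p ∈ X := (Submodule.orthogonalProjectionOnto X v).2
  have hNpos : (0 : ℝ) < N := by exact_mod_cast hN
  have hpv : ⟪p, v⟫ = ((‖p‖ ^ 2 : ℝ) : ℂ) := by
    have h0 : ⟪p, p⟫ = ⟪p, v⟫ :=
      Submodule.inner_orthogonalProjectionOnto_eq_of_mem_left
        (Submodule.orthogonalProjectionOnto X v) v
    rw [← h0, inner_self_eq_norm_sq_to_K]
    simp
  have hle : ‖p‖ ≤ ‖v‖ := Submodule.norm_orthogonalProjectionOnto_apply_le X v
  have hsum : ⟪∑ j, u j p, v⟫ = ((N * ‖p‖ ^ 2 : ℝ) : ℂ) := by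
    have hj (j : Fin N) : ⟪u j p, v⟫ = ((‖p‖ ^ 2 : ℝ) : ℂ) := by
      rw [← hpv, ← (u j).inner_map_map p v, hv j]
    simp [hj]
  have hcs : N * ‖p‖ ^ 2 ≤ ‖∑ j, u j p‖ * ‖v‖ := by
    have := norm_inner_le_norm (𝕜 := ℂ) (∑ j, u j p) v
    rwa [hsum, Complex.norm_real, Real.norm_of_nonneg (by positivity)] at this
  have hw : ‖∑ j, u j p‖ ^ 2 ≤ 2 * N * ‖p‖ ^ 2 := by
    refine norm_sum_sq_le_of_almost_orthogonal hN _ (fun j => (u j).norm_map p) fun i j hij => ?_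
    refine (horth i j hij p hpX p hpX).trans_eq ?_
    rw [(u i).norm_map, (u j).norm_map]
    ring
  have hsq : (N : ℝ) * (N * (‖p‖ ^ 2) ^ 2) ≤ N * (2 * (‖v‖ ^ 2) ^ 2) :=
    calc (N : ℝ) * (N * (‖p‖ ^ 2) ^ 2) = (N * ‖p‖ ^ 2) ^ 2 := by ring
      _ ≤ (‖∑ j, u j p‖ * ‖v‖) ^ 2 := by gcongr
      _ = ‖∑ j, u j p‖ ^ 2 * ‖v‖ ^ 2 := by ring
      _ ≤ 2 * N * ‖p‖ ^ 2 * ‖v‖ ^ 2 := by gcongr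
      _ ≤ 2 * N * ‖v‖ ^ 2 * ‖v‖ ^ 2 := by gcongr
      _ = N * (2 * (‖v‖ ^ 2) ^ 2) := by ring
  refine (sq_le_sq₀ (by positivity) (by positivity)).1 ?_
  rw [mul_pow, div_pow, Real.sq_sqrt zero_le_two, Real.sq_sqrt hNpos.le, div_mul_eq_mul_div,
    le_div_iff₀ hNpos, mul_comm]
  exact le_of_mul_le_mul_left hsq hNpos
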